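/- Let N = 1 and c ∈ ℝ with c + 1 > 0. Then for every q ≥ 2 there exists a constant C > 0 such that for every u ∈ C_c^∞(cl(ℝ²_+)) one has ‖u‖_{L^q_c} ≤ C (∫_{ℝ²_+} y^{2((c+2)/q − c/2)} |∇u(x,y)|² y^c dx dy)^{1/2}. -/

import Mathlib

open MeasureTheory Real

noncomputable section

/-- The upper half-plane `ℝ²_+`. -/
def HP : Set (ℝ × ℝ) := {z | 0 < z.2}

/-- Partial derivative of `u` in the `x` direction. -/
def pX2 (u : ℝ × ℝ → ℝ) (z : ℝ × ℝ) : ℝ := fderiv ℝ u z (1, 0)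

/-- Partial derivative of `u` in the `y` direction. -/
def pY2 (u : ℝ × ℝ → ℝ) (z : ℝ × ℝ) : ℝ := fderiv ℝ u z (0, 1)

/-- Euclidean norm of the full gradient `∇u`. -/
def gradNorm2 (u : ℝ × ℝ → ℝ) (z : ℝ × ℝ) : ℝ :=
  Real.sqrt (pX2 u z ^ 2 + pY2 u z ^ 2)

theorem alg_final {q d C1 C2 F P R S E : ℝ} (hq : 2 ≤ q) (hd : 2 ≤ d)
    (hC1 : 0 < C1) (hC2 : 0 < C2) (hF : 0 ≤ F) (hP : 0 ≤ P) (hE : 0 ≤ E) (hS : 0 ≤ S)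
    (hB : P ≤ C1 * R * E) (h1 : R ≤ F ^ (2 / d) * P ^ (1 - 2 / d))
    (h2 : S ≤ F ^ (1 - (q - 2) / d) * P ^ ((q - 2) / d))
    (hA : F ≤ C2 * E ^ (1 / 2 : ℝ) * S ^ (1 / 2 : ℝ)) :
    F ^ (1 / q) ≤ (C2 * (C1 ^ ((q - 2) / 4))) ^ (2 / q) * E ^ (1 / 2 : ℝ) := by
  have hd0 : 0 < d := by linarith
  have hq0 : 0 < q := by linarith
  rcases hF.eq_or_lt with h0 | hF0
  · rw [← h0, Real.zero_rpow (by positivity)]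
    positivity
  have hPK : P ≤ C1 ^ (d / 2) * F * E ^ (d / 2) := by
    rcases hP.eq_or_lt with h0 | hP0
    · rw [← h0]; positivity
    have e1 : P ^ (2 / d) ≤ C1 * F ^ (2 / d) * E := by
      have hpp : 0 < P ^ (1 - 2 / d) := by positivity
      refine le_of_mul_le_mul_right ?_ hpp
      rw [← Real.rpow_add hP0]
      calc P ^ (2 / d + (1 - 2 / d)) = P := by
            rw [show 2 / d + (1 - 2 / d) = 1 by ring, Real.rpow_one]
        _ ≤ C1 * R * E := hB
        _ ≤ C1 * (F ^ (2 / d) * P ^ (1 - 2 / d)) * E := by gcongr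
        _ = _ := by ring
    have e2 := Real.rpow_le_rpow (by positivity) e1 (show 0 ≤ d / 2 by positivity)
    rw [← Real.rpow_mul hP, Real.mul_rpow (by positivity) hE, Real.mul_rpow hC1.le (by positivity),
      ← Real.rpow_mul hF, show 2 / d * (d / 2) = 1 by field_simp, Real.rpow_one, Real.rpow_one] at e2
    exact e2
  have hs : 0 ≤ (q - 2) / d := div_nonneg (by linarith) hd0.le
  have hSK : S ≤ C1 ^ ((q - 2) / 2) * F * E ^ ((q - 2) / 2) := by
    calc S ≤ F ^ (1 - (q - 2) / d) * P ^ ((q - 2) / d) := h2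
      _ ≤ F ^ (1 - (q - 2) / d) * (C1 ^ (d / 2) * F * E ^ (d / 2)) ^ ((q - 2) / d) := by gcongr
      _ = C1 ^ ((q - 2) / 2) * (F ^ (1 - (q - 2) / d) * F ^ ((q - 2) / d)) * E ^ ((q - 2) / 2) := by
        rw [Real.mul_rpow (by positivity) (by positivity), Real.mul_rpow (by positivity) hF,
          ← Real.rpow_mul hC1.le, ← Real.rpow_mul hE,
          show d / 2 * ((q - 2) / d) = (q - 2) / 2 by field_simp]
        ring
      _ = _ := by
        rw [← Real.rpow_add hF0, show 1 - (q - 2) / d + (q - 2) / d = 1 by ring, Real.rpow_one]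
  have hF2 : F ^ (1 / 2 : ℝ) ≤ C2 * C1 ^ ((q - 2) / 4) * E ^ (q / 4) := by
    have hpp : 0 < F ^ (1 / 2 : ℝ) := by positivity
    refine le_of_mul_le_mul_right ?_ hpp
    rw [← Real.rpow_add hF0]
    calc F ^ (1 / 2 + 1 / 2 : ℝ) = F := by norm_num
      _ ≤ C2 * E ^ (1 / 2 : ℝ) * S ^ (1 / 2 : ℝ) := hA
      _ ≤ C2 * E ^ (1 / 2 : ℝ) * (C1 ^ ((q - 2) / 2) * F * E ^ ((q - 2) / 2)) ^ (1 / 2 : ℝ) := by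
        gcongr
      _ = C2 * C1 ^ ((q - 2) / 4) * (E ^ (1 / 2 : ℝ) * E ^ ((q - 2) / 4)) * F ^ (1 / 2 : ℝ) := by
        rw [Real.mul_rpow (by positivity) (by positivity), Real.mul_rpow (by positivity) hF,
          ← Real.rpow_mul hC1.le, ← Real.rpow_mul hE,
          show (q - 2) / 2 * (1 / 2) = (q - 2) / 4 by ring]
        ring
      _ = _ := by
        rw [← Real.rpow_add_of_nonneg hE (by norm_num) (by linarith),
          show 1 / 2 + (q - 2) / 4 = q / 4 by ring]
  have e := Real.rpow_le_rpow (by positivity) hF2 (show 0 ≤ 2 / q by positivity)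
  rw [← Real.rpow_mul hF, Real.mul_rpow (by positivity) (by positivity), ← Real.rpow_mul hE] at e
  rw [show 1 / q = 1 / 2 * (2 / q) by field_simp, show (1 / 2 : ℝ) = q / 4 * (2 / q) by field_simp; norm_num]
  convert e using 2
  field_simp; norm_num

open scoped ENNReal

/-- Lebesgue measure on the half plane as a product measure. -/
def muHP : Measure (ℝ × ℝ) := (volume : Measure ℝ).prod (volume.restrict (Set.Ioi (0 : ℝ)))

theorem muHP_eq : muHP = (volume : Measure (ℝ × ℝ)).restrict HP := by
  have h : HP = Set.univ ×ˢ Set.Ioi (0 : ℝ) := by ext z; simp [HP]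
  rw [h, Measure.volume_eq_prod, ← Measure.prod_restrict, Measure.restrict_univ]
  rfl

theorem measurableSet_HP : MeasurableSet HP := measurableSet_lt measurable_const measurable_snd

theorem ae_muHP_pos : ∀ᵐ z ∂muHP, 0 < z.2 := by
  rw [muHP_eq]
  exact ae_restrict_mem measurableSet_HP

/-- weighted integrals -/
def FF (U : ℝ × ℝ → ℝ≥0∞) (k p : ℝ) : ℝ≥0∞ :=
  ∫⁻ z, U z ^ p * ENNReal.ofReal z.2 ^ (k * p - 2) ∂muHP

def EE (D : ℝ × ℝ → ℝ≥0∞) (k : ℝ) : ℝ≥0∞ :=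
  ∫⁻ z, D z ^ (2 : ℝ) * ENNReal.ofReal z.2 ^ (2 * k) ∂muHP

theorem FF_interp {U : ℝ × ℝ → ℝ≥0∞} (hU : Measurable U) (k : ℝ) {p q a b r : ℝ}
    (hp : 0 ≤ p) (hq : 0 ≤ q)
    (ha : 0 ≤ a) (hb : 0 ≤ b) (hab : a + b = 1) (hr : r = a * p + b * q) :
    FF U k r ≤ FF U k p ^ a * FF U k q ^ b := by
  refine le_trans (le_of_eq ?_) (ENNReal.lintegral_mul_norm_pow_le (by fun_prop) (by fun_prop) ha hb hab)
  refine lintegral_congr_ae ?_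
  filter_upwards [ae_muHP_pos] with z hz
  have h0 : ENNReal.ofReal z.2 ≠ 0 := by simpa using hz
  rw [ENNReal.mul_rpow_of_nonneg _ _ ha, ENNReal.mul_rpow_of_nonneg _ _ hb, ← ENNReal.rpow_mul,
    ← ENNReal.rpow_mul, ← ENNReal.rpow_mul, ← ENNReal.rpow_mul, mul_mul_mul_comm,
    ← ENNReal.rpow_add _ _ h0 ENNReal.ofReal_ne_top,
    ← ENNReal.rpow_add_of_nonneg _ _ (by positivity) (by positivity)]
  have : b = 1 - a := by linarith
  subst this
  congr 2
  · rw [hr]; ring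
  · rw [hr]; ring

theorem cs_lemma {U D : ℝ × ℝ → ℝ≥0∞} (hU : Measurable U) (hD : Measurable D) (k p : ℝ) :
    ∫⁻ z, U z ^ (p / 2) * D z * ENNReal.ofReal z.2 ^ (k * (p / 2) - 1 + k) ∂muHP
      ≤ FF U k p ^ (1 / 2 : ℝ) * EE D k ^ (1 / 2 : ℝ) := by
  refine le_trans (le_of_eq ?_) (ENNReal.lintegral_mul_norm_pow_le (by fun_prop) (by fun_prop)
    (by norm_num) (by norm_num) (by norm_num))
  refine lintegral_congr_ae ?_
  filter_upwards [ae_muHP_pos] with z hz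
  have h0 : ENNReal.ofReal z.2 ≠ 0 := by simpa using hz
  rw [ENNReal.mul_rpow_of_nonneg _ _ (by norm_num), ENNReal.mul_rpow_of_nonneg _ _ (by norm_num),
    ← ENNReal.rpow_mul, ← ENNReal.rpow_mul, ← ENNReal.rpow_mul, ← ENNReal.rpow_mul, mul_mul_mul_comm,
    ← ENNReal.rpow_add _ _ h0 ENNReal.ofReal_ne_top]
  rw [show (2 : ℝ) * (1 / 2) = 1 by norm_num, ENNReal.rpow_one, show p * (1 / 2) = p / 2 by ring]
  congr 2
  ring

theorem lintegral_rpow_Ioo {c t : ℝ} (hc : -1 < c) (ht : 0 < t) :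
    ∫⁻ y in Set.Ioo 0 t, ENNReal.ofReal y ^ c
      = ENNReal.ofReal (1 / (c + 1)) * ENNReal.ofReal t ^ (c + 1) := by
  have hc' : 0 < c + 1 := by linarith
  have h1 : ∫⁻ y in Set.Ioo 0 t, ENNReal.ofReal y ^ c = ∫⁻ y in Set.Ioo 0 t, ENNReal.ofReal (y ^ c) := by
    refine setLIntegral_congr_fun measurableSet_Ioo ?_
    intro y hy
    exact ENNReal.ofReal_rpow_of_pos hy.1
  have hi : IntegrableOn (fun y : ℝ => y ^ c) (Set.Ioc 0 t) := by
    have := intervalIntegral.intervalIntegrable_rpow' (a := 0) (b := t) hc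
    rwa [intervalIntegrable_iff_integrableOn_Ioc_of_le ht.le] at this
  rw [h1, setLIntegral_congr Ioo_ae_eq_Ioc, ← ofReal_integral_eq_lintegral_ofReal hi,
    ← intervalIntegral.integral_of_le ht.le, integral_rpow (Or.inl hc), Real.zero_rpow hc'.ne',
    ENNReal.ofReal_rpow_of_pos ht, ← ENNReal.ofReal_mul (by positivity)]
  · congr 1; ring
  · filter_upwards [ae_restrict_mem measurableSet_Ioc] with y hy
    exact Real.rpow_nonneg hy.1.le _

theorem hardy_swap {g : ℝ → ℝ≥0∞} (hg : Measurable g) {c : ℝ} (hc : -1 < c) :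
    ∫⁻ y in Set.Ioi (0 : ℝ), ENNReal.ofReal y ^ c * ∫⁻ t in Set.Ioi y, g t
      = ENNReal.ofReal (1 / (c + 1)) * ∫⁻ t in Set.Ioi (0 : ℝ), g t * ENNReal.ofReal t ^ (c + 1) := by
  have e1 : ∫⁻ y in Set.Ioi (0 : ℝ), ENNReal.ofReal y ^ c * ∫⁻ t in Set.Ioi y, g t
      = ∫⁻ y in Set.Ioi (0 : ℝ), ∫⁻ t in Set.Ioi (0 : ℝ),
        ({w : ℝ × ℝ | w.1 < w.2}.indicator (fun w => ENNReal.ofReal w.1 ^ c * g w.2)) (y, t) := by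
    refine setLIntegral_congr_fun measurableSet_Ioi ?_
    intro y hy
    have hy' : 0 < y := hy
    simp only
    rw [← lintegral_const_mul _ hg]
    rw [← lintegral_indicator measurableSet_Ioi, ← lintegral_indicator measurableSet_Ioi]
    refine lintegral_congr fun t => ?_
    by_cases h : y < t
    · have : 0 < t := hy'.trans h
      simp [Set.indicator, h, this]
    · simp [Set.indicator, h]
  have hm : MeasurableSet {w : ℝ × ℝ | w.1 < w.2} := measurableSet_lt measurable_fst measurable_snd
  rw [e1, lintegral_lintegral_swap]
  · rw [← lintegral_const_mul _ (by fun_prop)]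
    refine setLIntegral_congr_fun measurableSet_Ioi ?_
    intro t ht
    have ht' : 0 < t := ht
    simp only
    calc _ = ∫⁻ y in Set.Ioo 0 t, g t * ENNReal.ofReal y ^ c := by
          rw [← lintegral_indicator measurableSet_Ioi, ← lintegral_indicator measurableSet_Ioo]
          refine lintegral_congr fun y => ?_
          by_cases h : y < t
          · by_cases h0 : 0 < y
            · simp [Set.indicator, h, h0, mul_comm]
            · simp [Set.indicator, h0]
          · simp [Set.indicator, h]
      _ = _ := by
          rw [lintegral_const_mul _ (by fun_prop), lintegral_rpow_Ioo hc ht']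
          ring
  · refine Measurable.aemeasurable ?_
    exact Measurable.indicator (by fun_prop) hm

theorem stepA {U D : ℝ × ℝ → ℝ≥0∞} (hU : Measurable U) (hD : Measurable D) {k q : ℝ} (hq : 2 ≤ q)
    (hk : 1 < k * q)
    (hY : ∀ s : ℝ, 1 < s → ∀ x y, U (x, y) ^ s ≤
      ENNReal.ofReal s * ∫⁻ t in Set.Ioi y, U (x, t) ^ (s - 1) * D (x, t)) :
    FF U k q ≤ ENNReal.ofReal (q / (k * q - 1)) *
      (FF U k (2 * q - 2) ^ (1 / 2 : ℝ) * EE D k ^ (1 / 2 : ℝ)) := by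
  refine le_trans ?_ (mul_le_mul_right (cs_lemma hU hD k (2 * q - 2)) _)
  rw [FF, muHP, lintegral_prod _ (by fun_prop), lintegral_prod _ (by fun_prop),
    ← lintegral_const_mul _ (by fun_prop)]
  refine lintegral_mono fun x => ?_
  simp only
  calc _ ≤ ∫⁻ y in Set.Ioi (0 : ℝ), ENNReal.ofReal q * (ENNReal.ofReal y ^ (k * q - 2) *
          ∫⁻ t in Set.Ioi y, U (x, t) ^ (q - 1) * D (x, t)) := by
        refine lintegral_mono fun y => ?_
        simp only
        calc _ ≤ (ENNReal.ofReal q * ∫⁻ t in Set.Ioi y, U (x, t) ^ (q - 1) * D (x, t)) *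
              ENNReal.ofReal y ^ (k * q - 2) := by
              gcongr; exact hY q (by linarith) x y
          _ = _ := by ring
    _ = ENNReal.ofReal q * (ENNReal.ofReal (1 / (k * q - 2 + 1)) *
        ∫⁻ t in Set.Ioi (0 : ℝ), (U (x, t) ^ (q - 1) * D (x, t)) * ENNReal.ofReal t ^ (k * q - 2 + 1)) := by
        rw [lintegral_const_mul' _ _ ENNReal.ofReal_ne_top, hardy_swap (by fun_prop) (by linarith)]
    _ = _ := by
        rw [← mul_assoc, ← ENNReal.ofReal_mul (by linarith)]
        congr 2
        · congr 1
          rw [one_div]; congr 1; ring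
        · ext t
          congr 2
          · congr 2; ring
          · ring

theorem stepB {U D : ℝ × ℝ → ℝ≥0∞} (hU : Measurable U) (hD : Measurable D) {k p : ℝ} (hp : 4 ≤ p)
    (hk : 2 ≤ k * p)
    (hX : ∀ s : ℝ, 1 < s → ∀ x y, U (x, y) ^ s ≤
      ENNReal.ofReal s * ∫⁻ t, U (t, y) ^ (s - 1) * D (t, y))
    (hY : ∀ s : ℝ, 1 < s → ∀ x y, U (x, y) ^ s ≤
      ENNReal.ofReal s * ∫⁻ t in Set.Ioi y, U (x, t) ^ (s - 1) * D (x, t)) :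
    FF U k p ≤ ENNReal.ofReal ((p / 2) ^ 2) * FF U k (p - 2) * EE D k := by
  have key := cs_lemma hU hD k (p - 2)
  set h : ℝ × ℝ → ℝ≥0∞ := fun z => U z ^ ((p - 2) / 2) * D z *
    ENNReal.ofReal z.2 ^ (k * ((p - 2) / 2) - 1 + k) with hh
  have hm : Measurable h := by fun_prop
  set s := p / 2 with hs
  have es : (p - 2) / 2 = s - 1 := by rw [hs]; ring
  have ee : k * ((p - 2) / 2) - 1 + k = k * s - 1 := by rw [hs]; ring
  have hks : 0 ≤ k * s - 1 := by rw [hs]; linarith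
  have b1 : ∀ x y, U (x, y) ^ s * ENNReal.ofReal y ^ (k * s - 1) ≤
      ENNReal.ofReal s * ∫⁻ t, h (t, y) := by
    intro x y
    calc _ ≤ (ENNReal.ofReal s * ∫⁻ t, U (t, y) ^ (s - 1) * D (t, y)) *
          ENNReal.ofReal y ^ (k * s - 1) := by
          gcongr; exact hX s (by linarith) x y
      _ = _ := by
          rw [mul_assoc, ← lintegral_mul_const _ (by fun_prop)]
          simp only [hh, es]
          congr 4; rw [← ee, es]
  have b2 : ∀ x y, 0 < y → U (x, y) ^ s * ENNReal.ofReal y ^ (k * s - 1) ≤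
      ENNReal.ofReal s * ∫⁻ t in Set.Ioi (0 : ℝ), h (x, t) := by
    intro x y hy
    calc _ ≤ (ENNReal.ofReal s * ∫⁻ t in Set.Ioi y, U (x, t) ^ (s - 1) * D (x, t)) *
          ENNReal.ofReal y ^ (k * s - 1) := by
          gcongr; exact hY s (by linarith) x y
      _ = ENNReal.ofReal s * ∫⁻ t in Set.Ioi y, U (x, t) ^ (s - 1) * D (x, t) *
          ENNReal.ofReal y ^ (k * s - 1) := by
          rw [mul_assoc, ← lintegral_mul_const _ (by fun_prop)]
      _ ≤ ENNReal.ofReal s * ∫⁻ t in Set.Ioi y, h (x, t) := by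
          refine mul_le_mul_right ?_ _
          refine setLIntegral_mono' measurableSet_Ioi fun t ht => ?_
          have ht' : y < t := ht
          simp only [hh, ee]
          rw [es]
          gcongr
      _ ≤ _ := by
          gcongr
  have hFF : FF U k p ≤ ∫⁻ z, (ENNReal.ofReal s * ∫⁻ t in Set.Ioi (0 : ℝ), h (z.1, t)) *
      (ENNReal.ofReal s * ∫⁻ t, h (t, z.2)) ∂muHP := by
    refine lintegral_mono_ae ?_
    filter_upwards [ae_muHP_pos] with z hz
    have h0 : ENNReal.ofReal z.2 ≠ 0 := by simpa using hz
    refine le_trans (le_of_eq ?_) (mul_le_mul' (b2 z.1 z.2 hz) (b1 z.1 z.2))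
    rw [mul_mul_mul_comm, ← ENNReal.rpow_add_of_nonneg _ _ (by linarith) (by linarith),
      ← ENNReal.rpow_add _ _ h0 ENNReal.ofReal_ne_top]
    congr 2
    · rw [hs]; ring
    · rw [hs]; ring
  rw [muHP, lintegral_prod_mul (f := fun x => ENNReal.ofReal s * ∫⁻ t in Set.Ioi (0 : ℝ), h (x, t))
    (g := fun y => ENNReal.ofReal s * ∫⁻ t, h (t, y))] at hFF
  · rw [lintegral_const_mul' _ _ ENNReal.ofReal_ne_top, lintegral_const_mul' _ _ ENNReal.ofReal_ne_top,
      ← lintegral_prod _ hm.aemeasurable, ← lintegral_prod_symm' _ hm] at hFF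
    refine hFF.trans ?_
    change ENNReal.ofReal s * (∫⁻ z, h z ∂muHP) * (ENNReal.ofReal s * (∫⁻ z, h z ∂muHP)) ≤ _
    have hsq : ∀ a : ℝ≥0∞, a ^ (1 / 2 : ℝ) * a ^ (1 / 2 : ℝ) = a := by
      intro a
      rw [← ENNReal.rpow_add_of_nonneg _ _ (by norm_num) (by norm_num)]; norm_num
    calc _ ≤ _ := mul_le_mul' (mul_le_mul_right key _) (mul_le_mul_right key _)
      _ = ENNReal.ofReal s * ENNReal.ofReal s *
          (FF U k (p - 2) ^ (1 / 2 : ℝ) * FF U k (p - 2) ^ (1 / 2 : ℝ)) *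
          (EE D k ^ (1 / 2 : ℝ) * EE D k ^ (1 / 2 : ℝ)) := by ring
      _ = _ := by
          rw [hsq, hsq, ← ENNReal.ofReal_mul (by linarith), sq]
  · exact (Measurable.const_mul (Measurable.lintegral_prod_right' hm) _).aemeasurable
  · exact (Measurable.const_mul (Measurable.lintegral_prod_left' hm) _).aemeasurable

theorem oneD {f : ℝ → ℝ} (hf : ContDiff ℝ 1 f) (h : HasCompactSupport f) {s : ℝ} (hs : 1 < s) (y : ℝ) :
    ‖f y‖ₑ ^ s ≤ ENNReal.ofReal s * ∫⁻ t in Set.Ioi y, ‖f t‖ₑ ^ (s - 1) * ‖deriv f t‖ₑ := by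
  set g : ℝ → ℝ := fun t => ‖f (-t)‖ ^ s with hg
  have hg1 : ContDiff ℝ 1 g := (hf.comp contDiff_neg).norm_rpow hs
  have hfc : HasCompactSupport (fun t => f (-t)) := h.comp_homeomorph (Homeomorph.neg ℝ)
  have hgc : HasCompactSupport g := by
    refine hfc.comp_left (g := fun r : ℝ => ‖r‖ ^ s) ?_
    simp [Real.zero_rpow (by linarith : s ≠ 0)]
  have key := hgc.enorm_le_lintegral_Ici_deriv hg1 (-y)
  have hd : ∀ t, ‖deriv g t‖ₑ ≤ ENNReal.ofReal s * (‖f (-t)‖ₑ ^ (s - 1) * ‖deriv f (-t)‖ₑ) := by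
    intro t
    have h1 : HasDerivAt (fun t => f (-t)) (-deriv f (-t)) t := by
      have := (hf.differentiable one_ne_zero (-t)).hasDerivAt.comp t (hasDerivAt_neg t)
      rw [mul_neg_one] at this
      exact this
    have h2 : HasDerivAt g (s * ‖f (-t)‖ ^ (s - 2) * f (-t) * (-deriv f (-t))) t :=
      HasDerivAt.comp (h₂ := fun x : ℝ => ‖x‖ ^ s) t (hasDerivAt_norm_rpow (f (-t)) hs) h1
    rw [h2.deriv]
    rw [← ofReal_norm, ← ofReal_norm, ← ofReal_norm,
      ENNReal.ofReal_rpow_of_nonneg (norm_nonneg _) (by linarith),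
      ← ENNReal.ofReal_mul (by positivity), ← ENNReal.ofReal_mul (by positivity)]
    refine ENNReal.ofReal_le_ofReal (le_of_eq ?_)
    rw [norm_mul, norm_mul, norm_mul, norm_neg, Real.norm_of_nonneg (by linarith : 0 ≤ s),
      Real.norm_of_nonneg (by positivity : 0 ≤ ‖f (-t)‖ ^ (s - 2))]
    rcases eq_or_ne (f (-t)) 0 with h0 | h0
    · simp [h0, Real.zero_rpow (by linarith : s - 1 ≠ 0)]
    · have : ‖f (-t)‖ ^ (s - 1) = ‖f (-t)‖ ^ (s - 2) * ‖f (-t)‖ := by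
        rw [← Real.rpow_add_one (by simpa using h0)]; congr 1; ring
      rw [this]; ring
  have e0 : ‖g (-y)‖ₑ = ‖f y‖ₑ ^ s := by
    simp only [hg, neg_neg]
    rw [← ofReal_norm, ← ofReal_norm, ENNReal.ofReal_rpow_of_nonneg (norm_nonneg _) (by linarith),
      Real.norm_of_nonneg (by positivity)]
  rw [e0] at key
  refine key.trans ((lintegral_mono hd).trans (le_of_eq ?_))
  rw [lintegral_const_mul' _ _ ENNReal.ofReal_ne_top]
  congr 1
  rw [setLIntegral_congr (Ioi_ae_eq_Ici (a := y))]
  have := (Measure.measurePreserving_neg (volume : Measure ℝ)).setLIntegral_comp_preimage_emb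
    (Homeomorph.neg ℝ).measurableEmbedding (fun t => ‖f t‖ₑ ^ (s - 1) * ‖deriv f t‖ₑ) (Set.Ici y)
  rw [← this]
  congr 2
  ext t; simp

theorem int_lemma {g : ℝ × ℝ → ℝ} (hg : Continuous g) (h : HasCompactSupport g) {c : ℝ} (hc : -1 < c) :
    Integrable (fun z : ℝ × ℝ => g z * z.2 ^ c)
      ((volume : Measure ℝ).prod (volume.restrict (Set.Ioi (0 : ℝ)))) := by
  obtain ⟨M, hM⟩ := hg.bounded_above_of_compact_support h
  obtain ⟨R, hR⟩ := h.isCompact.isBounded.subset_closedBall (0 : ℝ × ℝ)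
  have hsub : ∀ z : ℝ × ℝ, g z ≠ 0 → z.1 ∈ Set.Icc (-R) R ∧ z.2 ≤ R := by
    intro z hz
    have : z ∈ Metric.closedBall (0 : ℝ × ℝ) R := hR (subset_tsupport _ hz)
    simp only [Metric.mem_closedBall, dist_zero_right, Prod.norm_def, sup_le_iff, Real.norm_eq_abs] at this
    exact ⟨abs_le.mp this.1, (abs_le.mp this.2).2⟩
  have i1 : Integrable ((Set.Icc (-R) R).indicator (fun _ : ℝ => M)) volume := by
    rw [integrable_indicator_iff measurableSet_Icc]
    exact integrableOn_const (by simp)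
  have i2 : Integrable ((Set.Iic R).indicator (fun y : ℝ => y ^ c)) (volume.restrict (Set.Ioi (0 : ℝ))) := by
    rw [integrable_indicator_iff measurableSet_Iic, IntegrableOn, Measure.restrict_restrict measurableSet_Iic,
      Set.inter_comm, Set.Ioi_inter_Iic]
    rcases le_or_gt 0 R with h0 | h0
    · have := intervalIntegral.intervalIntegrable_rpow' (a := 0) (b := R) hc
      rwa [intervalIntegrable_iff_integrableOn_Ioc_of_le h0] at this
    · simp [Set.Ioc_eq_empty (not_lt.mpr h0.le)]
  refine (i1.mul_prod i2).mono' (by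
    refine Measurable.aestronglyMeasurable ?_
    have := hg.measurable
    fun_prop) ?_
  have hae : ∀ᵐ z : ℝ × ℝ ∂((volume : Measure ℝ).prod (volume.restrict (Set.Ioi (0 : ℝ)))), 0 < z.2 :=
    Measure.quasiMeasurePreserving_snd.ae (ae_restrict_mem measurableSet_Ioi)
  filter_upwards [hae] with z hz
  by_cases h0 : g z = 0
  · simp only [h0, zero_mul, norm_zero]
    have hM0 : 0 ≤ M := (norm_nonneg _).trans (hM 0)
    exact mul_nonneg (Set.indicator_nonneg (fun _ _ => hM0) _)
      (by rw [Set.indicator_apply]; split_ifs <;> positivity)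
  · obtain ⟨a, b⟩ := hsub z h0
    rw [Set.indicator_of_mem a, Set.indicator_of_mem (show z.2 ∈ Set.Iic R from b), norm_mul,
      Real.norm_of_nonneg (by positivity : 0 ≤ z.2 ^ c)]
    gcongr
    exact hM z

theorem conv_lemma {v : ℝ × ℝ → ℝ} (hv : Continuous v) (h : HasCompactSupport v) {p r : ℝ}
    (hp : 0 < p) (hr : -1 < r) :
    ∫⁻ z, ‖v z‖ₑ ^ p * ENNReal.ofReal z.2 ^ r ∂muHP = ENNReal.ofReal (∫ z in HP, |v z| ^ p * z.2 ^ r) := by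
  have hi : Integrable (fun z : ℝ × ℝ => |v z| ^ p * z.2 ^ r) muHP := by
    refine int_lemma (g := fun z => |v z| ^ p) ?_ ?_ hr
    · exact hv.abs.rpow_const fun _ => Or.inr hp.le
    · exact h.comp_left (g := fun r : ℝ => |r| ^ p) (by simp [Real.zero_rpow hp.ne'])
  rw [← muHP_eq, ofReal_integral_eq_lintegral_ofReal hi]
  · refine lintegral_congr_ae ?_
    filter_upwards [ae_muHP_pos] with z hz
    rw [ENNReal.ofReal_mul (by positivity), ← ofReal_norm, Real.norm_eq_abs,
      ENNReal.ofReal_rpow_of_nonneg (abs_nonneg _) hp.le, ENNReal.ofReal_rpow_of_pos hz]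
  · filter_upwards [ae_muHP_pos] with z hz
    positivity

theorem fiberX {u : ℝ × ℝ → ℝ} (hu : ContDiff ℝ 1 u) (h : HasCompactSupport u) (s : ℝ) (hs : 1 < s)
    (x y : ℝ) : ‖u (x, y)‖ₑ ^ s ≤
      ENNReal.ofReal s * ∫⁻ t, ‖u (t, y)‖ₑ ^ (s - 1) * ‖gradNorm2 u (t, y)‖ₑ := by
  have hc : HasCompactSupport (fun t => u (t, y)) :=
    h.comp_isClosedEmbedding (g := fun t : ℝ => (t, y)) (Isometry.isClosedEmbedding (by intro a b; simp [Prod.edist_eq]))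
  have key := oneD (f := fun t => u (t, y)) (by fun_prop) hc hs x
  refine key.trans ?_
  refine mul_le_mul_right ?_ _
  refine (setLIntegral_le_lintegral _ _).trans (lintegral_mono fun t => ?_)
  simp only
  gcongr
  have hd : HasDerivAt (fun t => u (t, y)) (pX2 u (t, y)) t := by
    have h1 : HasDerivAt (fun t : ℝ => (t, y)) ((1 : ℝ), (0 : ℝ)) t :=
      (hasDerivAt_id t).prodMk (hasDerivAt_const t y)
    exact ((hu.differentiable one_ne_zero (t, y)).hasFDerivAt).comp_hasDerivAt t h1
  rw [hd.deriv, enorm_le_iff_norm_le, Real.norm_eq_abs, Real.norm_eq_abs]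
  refine le_trans ?_ (le_abs_self _)
  rw [gradNorm2]
  exact Real.abs_le_sqrt (by nlinarith [sq_nonneg (pY2 u (t, y))])

theorem fiberY {u : ℝ × ℝ → ℝ} (hu : ContDiff ℝ 1 u) (h : HasCompactSupport u) (s : ℝ) (hs : 1 < s)
    (x y : ℝ) : ‖u (x, y)‖ₑ ^ s ≤
      ENNReal.ofReal s * ∫⁻ t in Set.Ioi y, ‖u (x, t)‖ₑ ^ (s - 1) * ‖gradNorm2 u (x, t)‖ₑ := by
  have hc : HasCompactSupport (fun t => u (x, t)) :=
    h.comp_isClosedEmbedding (g := fun t : ℝ => (x, t)) (Isometry.isClosedEmbedding (by intro a b; simp [Prod.edist_eq]))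
  have key := oneD (f := fun t => u (x, t)) (by fun_prop) hc hs y
  refine key.trans ?_
  refine mul_le_mul_right ?_ _
  refine lintegral_mono fun t => ?_
  simp only
  gcongr
  have hd : HasDerivAt (fun t => u (x, t)) (pY2 u (x, t)) t := by
    have h1 : HasDerivAt (fun t : ℝ => (x, t)) ((0 : ℝ), (1 : ℝ)) t :=
      (hasDerivAt_const t x).prodMk (hasDerivAt_id t)
    exact ((hu.differentiable one_ne_zero (x, t)).hasFDerivAt).comp_hasDerivAt t h1
  rw [hd.deriv, enorm_le_iff_norm_le, Real.norm_eq_abs, Real.norm_eq_abs]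
  refine le_trans ?_ (le_abs_self _)
  rw [gradNorm2]
  exact Real.abs_le_sqrt (by nlinarith [sq_nonneg (pX2 u (x, t))])

theorem grad_cont {u : ℝ × ℝ → ℝ} (hu : ContDiff ℝ 1 u) : Continuous (gradNorm2 u) := by
  have := hu.continuous_fderiv one_ne_zero
  unfold gradNorm2 pX2 pY2
  fun_prop

theorem grad_supp {u : ℝ × ℝ → ℝ} (h : HasCompactSupport u) : HasCompactSupport (gradNorm2 u) :=
  (h.fderiv ℝ).comp_left
    (g := fun L : (ℝ × ℝ) →L[ℝ] ℝ => Real.sqrt (L (1, 0) ^ 2 + L (0, 1) ^ 2)) (by simp)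

/-- for `N = 1`, `c + 1 > 0` and any `q ≥ 2`,
`‖u‖_{L^q_c} ≤ C ‖y^{(c+2)/q − c/2} ∇u‖_{L²_c}` for all smooth compactly
supported `u` on the closed half-plane. -/
theorem stmt_7 (c : ℝ) (hc : c + 1 > 0) (q : ℝ) (hq : 2 ≤ q) :
    ∃ C > 0, ∀ u : ℝ × ℝ → ℝ, ContDiff ℝ (⊤ : ℕ∞) u → HasCompactSupport u →
      (∫ z in HP, |u z| ^ q * z.2 ^ c) ^ (1 / q) ≤
        C * (∫ z in HP, z.2 ^ (2 * ((c + 2) / q - c / 2)) * gradNorm2 u z ^ 2 * z.2 ^ c) ^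
          (1 / 2 : ℝ) := by
  have hq0 : 0 < q := by linarith
  have hc2 : 0 < c + 2 := by linarith
  set k : ℝ := (c + 2) / q with hk
  have hk0 : 0 < k := by positivity
  have hkq : k * q = c + 2 := by rw [hk]; field_simp
  set d : ℝ := q + 2 + 2 / k with hd
  have h2k : 0 < 2 / k := by positivity
  have hd0 : 0 < d := by linarith
  have hkd : 2 ≤ k * (q + d) := by
    have : k * (2 / k) = 2 := by field_simp
    rw [hd]; nlinarith
  have hC1 : 0 < ((q + d) / 2) ^ 2 := by positivity
  have hC2 : 0 < q / (k * q - 1) := div_pos hq0 (by linarith)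
  refine ⟨(q / (k * q - 1) * ((((q + d) / 2) ^ 2) ^ ((q - 2) / 4))) ^ (2 / q), by positivity, ?_⟩
  intro u hu hs
  have hu1 : ContDiff ℝ 1 u := hu.of_le (by exact_mod_cast le_top)
  have hcu := hu1.continuous
  have hcg := grad_cont hu1
  have hU : Measurable (fun z => ‖u z‖ₑ) := hcu.measurable.enorm
  have hD : Measurable (fun z => ‖gradNorm2 u z‖ₑ) := hcg.measurable.enorm
  have hfin : ∀ p, q ≤ p → FF (fun z => ‖u z‖ₑ) k p ≠ ⊤ := by
    intro p hp
    rw [FF, conv_lemma hcu hs (by linarith) (by nlinarith)]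
    exact ENNReal.ofReal_ne_top
  have hEeq := conv_lemma hcg (grad_supp hs) (p := 2) (r := 2 * k) (by norm_num) (by linarith)
  have hEf : EE (fun z => ‖gradNorm2 u z‖ₑ) k ≠ ⊤ := by
    rw [EE, hEeq]; exact ENNReal.ofReal_ne_top
  have hFq : ∫ z in HP, |u z| ^ q * z.2 ^ c = (FF (fun z => ‖u z‖ₑ) k q).toReal := by
    rw [FF, conv_lemma hcu hs hq0 (by linarith), hkq, show c + 2 - 2 = c by ring, ENNReal.toReal_ofReal]
    refine setIntegral_nonneg measurableSet_HP fun z hz => ?_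
    have : 0 < z.2 := hz
    positivity
  have hE : ∫ z in HP, z.2 ^ (2 * (k - c / 2)) * gradNorm2 u z ^ 2 * z.2 ^ c
      = (EE (fun z => ‖gradNorm2 u z‖ₑ) k).toReal := by
    rw [EE, hEeq, ENNReal.toReal_ofReal]
    · refine setIntegral_congr_fun measurableSet_HP fun z hz => ?_
      have hz' : 0 < z.2 := hz
      rw [Real.rpow_two, sq_abs, mul_right_comm, ← Real.rpow_add hz', mul_comm]
      congr 2; ring
    · refine setIntegral_nonneg measurableSet_HP fun z hz => ?_
      have : 0 < z.2 := hz
      positivity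
  rw [hFq, hE]
  have A := stepA hU hD hq (by linarith : 1 < k * q) (fiberY hu1 hs)
  have B := stepB hU hD (by linarith : 4 ≤ q + d) hkd (fiberX hu1 hs) (fiberY hu1 hs)
  have I1 := FF_interp hU k (p := q) (q := q + d) (a := 2 / d) (b := 1 - 2 / d) (r := q + d - 2)
    hq0.le (by linarith) (by positivity)
    (by rw [sub_nonneg, div_le_one hd0]; linarith) (by ring) (by field_simp; ring)
  have I2 := FF_interp hU k (p := q) (q := q + d) (a := 1 - (q - 2) / d) (b := (q - 2) / d)
    (r := 2 * q - 2)
    hq0.le (by linarith) (by rw [sub_nonneg, div_le_one hd0]; linarith)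
    (div_nonneg (by linarith) hd0.le) (by ring) (by field_simp; ring)
  have f1 := hfin q le_rfl
  have f2 := hfin (q + d) (by linarith)
  have f3 := hfin (q + d - 2) (by linarith)
  have f4 := hfin (2 * q - 2) (by linarith)
  have h0a : 0 ≤ 2 / d := by positivity
  have h0b : 0 ≤ 1 - 2 / d := by rw [sub_nonneg, div_le_one hd0]; linarith
  have h0c : 0 ≤ 1 - (q - 2) / d := by rw [sub_nonneg, div_le_one hd0]; linarith
  have h0d : 0 ≤ (q - 2) / d := div_nonneg (by linarith) hd0.le
  refine alg_final (d := d) (P := (FF (fun z => ‖u z‖ₑ) k (q + d)).toReal)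
    (R := (FF (fun z => ‖u z‖ₑ) k (q + d - 2)).toReal)
    (S := (FF (fun z => ‖u z‖ₑ) k (2 * q - 2)).toReal)
    hq (by linarith) hC1 hC2 ENNReal.toReal_nonneg ENNReal.toReal_nonneg ENNReal.toReal_nonneg
    ENNReal.toReal_nonneg ?_ ?_ ?_ ?_
  · have := ENNReal.toReal_mono (by finiteness) B
    rwa [ENNReal.toReal_mul, ENNReal.toReal_mul, ENNReal.toReal_ofReal hC1.le] at this
  · have := ENNReal.toReal_mono (by finiteness) I1
    rwa [ENNReal.toReal_mul, ← ENNReal.toReal_rpow, ← ENNReal.toReal_rpow] at this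
  · have := ENNReal.toReal_mono (by finiteness) I2
    rwa [ENNReal.toReal_mul, ← ENNReal.toReal_rpow, ← ENNReal.toReal_rpow] at this
  · have := ENNReal.toReal_mono (by finiteness) A
    rw [ENNReal.toReal_mul, ENNReal.toReal_mul, ← ENNReal.toReal_rpow, ← ENNReal.toReal_rpow,
      ENNReal.toReal_ofReal hC2.le] at this
    exact this.trans (le_of_eq (by ring))
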